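/- Let n ≥ 1 and let σ be a Z-retraction of [0,1]ⁿ whose range P = R_σ is a nonempty closed domain. Then the interior of P has finitely many connected components O₁,…,O_k, each of positive n-dimensional Lebesgue measure; and if λ denotes the minimum of the Lebesgue measures of O₁,…,O_k, then the number of Z-homeomorphism domains for σ is at most the binomial coefficient C(⌊1/λ⌋, k). -/

import Mathlib

open Set MeasureTheory

/-- The unit cube `[0,1]^n` in `ℝ^n`. -/
def cubeSet (n : ℕ) : Set (Fin n → ℝ) := Set.Icc 0 1

/-- A point all of whose coordinates are rational. -/
def IsRationalPoint {n : ℕ} (v : Fin n → ℝ) : Prop := ∀ i, ∃ q : ℚ, v i = (q : ℝ)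

/-- A rational polyhedron: a finite union of convex hulls of finite sets of rational points. -/
def IsRationalPolyhedron {n : ℕ} (P : Set (Fin n → ℝ)) : Prop :=
  ∃ S : Finset (Finset (Fin n → ℝ)),
    (∀ F ∈ S, ∀ v ∈ F, IsRationalPoint v) ∧
    P = ⋃ F ∈ S, convexHull ℝ (F : Set (Fin n → ℝ))

/-- An affine map `x ↦ Mx + b` with integer matrix `M` and integer vector `b`. -/
def IsIntAffine {n m : ℕ} (g : (Fin n → ℝ) → (Fin m → ℝ)) : Prop :=
  ∃ (M : Fin m → Fin n → ℤ) (b : Fin m → ℤ),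
    ∀ x i, g x i = (∑ j, (M i j : ℝ) * x j) + (b i : ℝ)

/-- A Z-map on `P`: continuous on `P`, with finitely many integer affine pieces. -/
def IsZMapOn {n m : ℕ} (P : Set (Fin n → ℝ)) (f : (Fin n → ℝ) → (Fin m → ℝ)) : Prop :=
  ContinuousOn f P ∧
  ∃ (k : ℕ) (g : Fin k → (Fin n → ℝ) → (Fin m → ℝ)),
    (∀ i, IsIntAffine (g i)) ∧ ∀ x ∈ P, ∃ i, f x = g i x

/-- `f` restricted to `P` is a Z-homeomorphism of `P` onto `Q`. -/
def IsZHomeoOnto {n m : ℕ} (P : Set (Fin n → ℝ)) (Q : Set (Fin m → ℝ))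
    (f : (Fin n → ℝ) → (Fin m → ℝ)) : Prop :=
  IsZMapOn P f ∧ f '' P = Q ∧ Set.InjOn f P ∧
  ∃ g : (Fin m → ℝ) → (Fin n → ℝ),
    IsZMapOn Q g ∧ (∀ x ∈ P, g (f x) = x) ∧ (∀ y ∈ Q, f (g y) = y)

/-- A Z-retraction of the cube `[0,1]^n`. -/
def IsZRetraction {n : ℕ} (σ : (Fin n → ℝ) → (Fin n → ℝ)) : Prop :=
  IsZMapOn (cubeSet n) σ ∧ Set.MapsTo σ (cubeSet n) (cubeSet n) ∧
  ∀ x ∈ cubeSet n, σ (σ x) = σ x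

/-- The range `R_σ = σ([0,1]^n)` of a Z-retraction. -/
def zRange {n : ℕ} (σ : (Fin n → ℝ) → (Fin n → ℝ)) : Set (Fin n → ℝ) := σ '' cubeSet n

/-- A Z-homeomorphism domain for `σ`: a rational polyhedron `Q ⊆ [0,1]^n` such that
`σ` restricted to `Q` is a Z-homeomorphism of `Q` onto `R_σ`. -/
def IsZHomeoDomain {n : ℕ} (σ : (Fin n → ℝ) → (Fin n → ℝ)) (Q : Set (Fin n → ℝ)) : Prop :=
  IsRationalPolyhedron Q ∧ Q ⊆ cubeSet n ∧ IsZHomeoOnto Q (zRange σ) σ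

/-- A (Kuratowski) closed domain: `D` equals the closure of its interior. -/
def IsClosedDomain {n : ℕ} (D : Set (Fin n → ℝ)) : Prop :=
  closure (interior D) = D

/-- A scalar integer affine map. -/
def IsIntAffine1 {n : ℕ} (g : (Fin n → ℝ) → ℝ) : Prop :=
  ∃ (m : Fin n → ℤ) (b : ℤ), ∀ x, g x = (∑ j, (m j : ℝ) * x j) + (b : ℝ)

/-- A scalar Z-map on `P`. -/
def IsZMapOn1 {n : ℕ} (P : Set (Fin n → ℝ)) (f : (Fin n → ℝ) → ℝ) : Prop :=
  ContinuousOn f P ∧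
  ∃ (k : ℕ) (g : Fin k → (Fin n → ℝ) → ℝ),
    (∀ i, IsIntAffine1 (g i)) ∧ ∀ x ∈ P, ∃ i, f x = g i x

/-- The free MV-algebra `McN([0,1]^n)`, viewed as a set of functions on the cube. -/
def McN (n : ℕ) : Set (↥(cubeSet n) → ℝ) :=
  { f | (∀ x, f x ∈ Set.Icc (0:ℝ) 1) ∧
    ∃ g : (Fin n → ℝ) → ℝ, IsZMapOn1 (cubeSet n) g ∧ ∀ x : ↥(cubeSet n), f x = g x.1 }

/-- Pointwise MV-sum `f ⊕ g = min(f + g, 1)`. -/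
def mvAdd {X : Type*} (f g : X → ℝ) : X → ℝ := fun x => min (f x + g x) 1

/-- Pointwise MV-negation `¬f = 1 - f`. -/
def mvNeg {X : Type*} (f : X → ℝ) : X → ℝ := fun x => 1 - f x

/-- The retract `A_σ = {g ∘ σ : g ∈ McN([0,1]^n)}` associated with a Z-retraction `σ`. -/
def retAlg {n : ℕ} (σ : (Fin n → ℝ) → (Fin n → ℝ)) : Set (↥(cubeSet n) → ℝ) :=
  { f | ∃ g ∈ McN n, ∀ (x : ↥(cubeSet n)) (h : σ x.1 ∈ cubeSet n), f x = g ⟨σ x.1, h⟩ }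

/-- `ε` is a retraction of `McN([0,1]^n)` onto `A`. -/
def IsMcNRetraction {n : ℕ} (ε : ↥(McN n) → ↥(McN n)) (A : Set (↥(cubeSet n) → ℝ)) : Prop :=
  (∀ (f g : ↥(McN n)) (h : mvAdd f.1 g.1 ∈ McN n),
      (ε ⟨mvAdd f.1 g.1, h⟩).1 = mvAdd (ε f).1 (ε g).1) ∧
  (∀ (f : ↥(McN n)) (h : mvNeg f.1 ∈ McN n),
      (ε ⟨mvNeg f.1, h⟩).1 = mvNeg (ε f).1) ∧
  (∀ f, ε (ε f) = ε f) ∧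
  Subtype.val '' Set.range ε = A

/-- An MV-isomorphism between two sets of `[0,1]`-valued functions. -/
def IsMVIsoFun {X Y : Type*} (A : Set (X → ℝ)) (B : Set (Y → ℝ)) (h : ↥A → ↥B) : Prop :=
  Function.Bijective h ∧
  (∀ (f g : ↥A) (hm : mvAdd f.1 g.1 ∈ A),
      (h ⟨mvAdd f.1 g.1, hm⟩).1 = mvAdd (h f).1 (h g).1) ∧
  (∀ (f : ↥A) (hm : mvNeg f.1 ∈ A),
      (h ⟨mvNeg f.1, hm⟩).1 = mvNeg (h f).1)

section PiecewiseAffine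

variable {E : Type*} [NormedAddCommGroup E] [NormedSpace ℝ E]

/-- The points at which none of the affine functionals in `Λ` vanishes. -/
def genericSet (Λ : Set (E →ᵃ[ℝ] ℝ)) : Set E := {x | ∀ l ∈ Λ, l x ≠ 0}

/-- Off the zero sets of the functionals in `Λ`, distinct maps in `L` take distinct values. -/
def Separates (Λ : Set (E →ᵃ[ℝ] ℝ)) (L : Set (E →ᵃ[ℝ] E)) : Prop :=
  ∀ A ∈ L, ∀ B ∈ L, ∀ x ∈ genericSet Λ, A x = B x → A = B

lemma AffineMap.apply_add_eq (F : E →ᵃ[ℝ] E) (x d : E) : F (x + d) = F x + F.linear d := by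
  rw [add_comm x d, ← vadd_eq_add, F.map_vadd, vadd_eq_add, add_comm]

lemma AffineMap.apply_add_eq_real (F : E →ᵃ[ℝ] ℝ) (x d : E) : F (x + d) = F x + F.linear d := by
  rw [add_comm x d, ← vadd_eq_add, F.map_vadd, vadd_eq_add, add_comm]

lemma AffineMap.eq_of_eqOn_isOpen {F G : E →ᵃ[ℝ] E} {U : Set E} (hU : IsOpen U)
    (hne : U.Nonempty) (h : EqOn F G U) : F = G :=
  AffineMap.ext_on (hU.affineSpan_eq_top hne) h

lemma eventually_add_smul_mem {U : Set E} (hU : IsOpen U) {x : E} (hx : x ∈ U) (d : E) :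
    ∀ᶠ t : ℝ in nhdsWithin 0 (Ioi 0), x + t • d ∈ U := by
  have hc : Continuous fun t : ℝ => x + t • d := by fun_prop
  have h : (fun t : ℝ => x + t • d) ⁻¹' U ∈ nhds (0 : ℝ) :=
    (hU.preimage hc).mem_nhds (by simpa using hx)
  exact nhdsWithin_le_nhds h

lemma exists_pos_add_smul_mem {U : Set E} (hU : IsOpen U) {x : E} (hx : x ∈ U) (d : E) :
    ∃ t : ℝ, 0 < t ∧ x + t • d ∈ U := by
  obtain ⟨t, h1, h2⟩ := ((eventually_add_smul_mem hU hx d).and self_mem_nhdsWithin).exists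
  exact ⟨t, h2, h1⟩

lemma AffineMap.linear_injective_of_injOn {F : E →ᵃ[ℝ] E} {U : Set E} (hU : IsOpen U)
    (hne : U.Nonempty) (h : InjOn F U) : Function.Injective F.linear := by
  rw [injective_iff_map_eq_zero]
  intro d hd
  obtain ⟨x, hx⟩ := hne
  obtain ⟨t, ht, hxt⟩ := exists_pos_add_smul_mem hU hx d
  have := h hxt hx (by rw [F.apply_add_eq, map_smul, hd, smul_zero, add_zero])
  simpa [ht.ne'] using this

/-- An affine map vanishing on the part of a hyperplane lying in an open set is a multiple of the
functional defining the hyperplane. -/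
lemma AffineMap.eq_smul_of_vanishing {D : E →ᵃ[ℝ] E} {l : E →ᵃ[ℝ] ℝ} {U : Set E}
    (hU : IsOpen U) {z v : E} (hz : z ∈ U) (hlz : l z = 0) (hv : l.linear v = 1)
    (hD : ∀ x ∈ U, l x = 0 → D x = 0) (x : E) : D x = l x • D.linear v := by
  have key : ∀ d, l.linear d = 0 → D.linear d = 0 := by
    intro d hd
    obtain ⟨t, ht, hzt⟩ := exists_pos_add_smul_mem hU hz d
    have h1 := hD _ hzt (by rw [l.apply_add_eq_real, map_smul, hd, hlz]; simp)
    rw [D.apply_add_eq, hD z hz hlz, zero_add, map_smul] at h1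
    exact (smul_eq_zero.1 h1).resolve_left ht.ne'
  have hx : l x = l.linear (x - z) := by
    have := l.apply_add_eq_real z (x - z)
    rw [hlz, zero_add, add_sub_cancel] at this
    exact this
  have h2 := key (x - z - l x • v) (by rw [map_sub, map_smul, hv, ← hx]; simp)
  rw [map_sub, map_smul, sub_eq_zero] at h2
  have h3 := D.apply_add_eq z (x - z)
  rw [hD z hz hlz, zero_add, add_sub_cancel] at h3
  rw [h3, h2]

lemma closed_halfspace_subset_closure {l : E →ᵃ[ℝ] ℝ} {U : Set E} (hU : IsOpen U) {v : E}
    (hv : l.linear v = 1) : U ∩ {x | 0 ≤ l x} ⊆ closure (U ∩ {x | 0 < l x}) := by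
  rintro x ⟨hxU, hx⟩
  rw [mem_closure_iff]
  intro W hW hxW
  obtain ⟨t, ht, hxt⟩ := exists_pos_add_smul_mem (hW.inter hU) ⟨hxW, hxU⟩ v
  refine ⟨_, hxt.1, hxt.2, ?_⟩
  simp only [mem_ofPred_eq] at hx ⊢
  rw [l.apply_add_eq_real, map_smul, hv, smul_eq_mul]
  linarith

variable [FiniteDimensional ℝ E]

/-- Two sections of the same map which are affine on either side of a hyperplane and which agree
on one side agree on the other side as well. -/
lemma eqOn_of_eqOn_halfspace {g g' s : E → E} {U : Set E} (hU : IsOpen U)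
    {l : E →ᵃ[ℝ] ℝ} {z v : E} (hz : z ∈ U) (hlz : l z = 0) (hv : l.linear v = 1)
    (hg : ContinuousOn g U) (hg' : ContinuousOn g' U)
    (hsg : ∀ x ∈ U, s (g x) = x) (hsg' : ∀ x ∈ U, s (g' x) = x)
    {F G G' : E →ᵃ[ℝ] E} (hF : EqOn g F (U ∩ {x | 0 < l x}))
    (hF' : EqOn g' F (U ∩ {x | 0 < l x}))
    (hG : EqOn g G (U ∩ {x | l x < 0})) (hG' : EqOn g' G' (U ∩ {x | l x < 0})) :
    EqOn g g' U := by
  have hsub : ∀ p : Set E, U ∩ p ⊆ U := fun _ => inter_subset_left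
  have contA : ∀ A : E →ᵃ[ℝ] E, Continuous A := fun A => A.continuous_of_finiteDimensional
  have contl : Continuous l := l.continuous_of_finiteDimensional
  have ext_pos : ∀ {h : E → E}, ContinuousOn h U → EqOn h F (U ∩ {x | 0 < l x}) →
      EqOn h F (U ∩ {x | 0 ≤ l x}) := fun hh he =>
    he.of_subset_closure (hh.mono (hsub _)) (contA F).continuousOn
      (inter_subset_inter_right _ fun x (hx : 0 < l x) => hx.le)
      (closed_halfspace_subset_closure hU hv)
  have hneg : (-l).linear (-v) = 1 := by simp [hv]
  have hcl := closed_halfspace_subset_closure (l := -l) hU hneg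
  have e1 : {x | 0 < (-l) x} = {x | l x < 0} := by ext x; simp
  have e2 : {x | 0 ≤ (-l) x} = {x | l x ≤ 0} := by ext x; simp
  rw [e1, e2] at hcl
  have ext_neg : ∀ {h : E → E} {A : E →ᵃ[ℝ] E}, ContinuousOn h U →
      EqOn h A (U ∩ {x | l x < 0}) → EqOn h A (U ∩ {x | l x ≤ 0}) := fun hh he =>
    he.of_subset_closure (hh.mono (hsub _)) (contA _).continuousOn
      (inter_subset_inter_right _ fun x (hx : l x < 0) => hx.le) hcl
  have gF := ext_pos hg hF
  have gF' := ext_pos hg' hF'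
  have gG := ext_neg hg hG
  have gG' := ext_neg hg' hG'
  have hpos : (U ∩ {x | 0 < l x}).Nonempty := by
    rw [← closure_nonempty_iff]
    exact ⟨z, closed_halfspace_subset_closure hU hv ⟨hz, hlz.ge⟩⟩
  have Finj : Function.Injective F.linear := by
    refine AffineMap.linear_injective_of_injOn
      (hU.inter (isOpen_lt continuous_const contl)) hpos fun x hx y hy hxy => ?_
    rw [← hF hx, ← hF hy] at hxy
    rw [← hsg x hx.1, ← hsg y hy.1, hxy]
  have Fsurj : Function.Surjective F.linear := LinearMap.injective_iff_surjective.1 Finj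
  have repr : ∀ {h : E → E} {A : E →ᵃ[ℝ] E}, EqOn h F (U ∩ {x | 0 ≤ l x}) →
      EqOn h A (U ∩ {x | l x ≤ 0}) → ∃ u, ∀ x, A x = F (x + l x • u) := by
    intro h A h1 h2
    obtain ⟨u, hu⟩ := Fsurj ((A - F).linear v)
    refine ⟨u, fun x => ?_⟩
    have h3 := AffineMap.eq_smul_of_vanishing (D := A - F) hU hz hlz hv (fun y hy hly => by
      have := (h1 ⟨hy, hly.ge⟩).symm.trans (h2 ⟨hy, hly.le⟩)
      simp [this]) x
    rw [F.apply_add_eq, map_smul, hu, ← h3]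
    simp
  obtain ⟨u, hu⟩ := repr gF gG
  obtain ⟨u', hu'⟩ := repr gF' gG'
  have near : ∀ W : Set E, IsOpen W → z ∈ W → ∃ x ∈ W, x ∈ U ∧ l x < 0 := by
    intro W hW hzW
    obtain ⟨x, hx1, hx2, hx3⟩ := mem_closure_iff.1 (hcl ⟨hz, hlz.le⟩) W hW hzW
    exact ⟨x, hx1, hx2, hx3⟩
  have shift : ∀ x w, l (x + l x • w) = l x * (1 + l.linear w) := by
    intro x w
    rw [l.apply_add_eq_real, map_smul, smul_eq_mul]
    ring
  have cpos : ∀ {h : E → E} {A : E →ᵃ[ℝ] E} {w : E}, (∀ x ∈ U, s (h x) = x) →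
      EqOn h F (U ∩ {x | 0 ≤ l x}) → EqOn h A (U ∩ {x | l x < 0}) →
      (∀ x, A x = F (x + l x • w)) → 0 < 1 + l.linear w := by
    intro h A w hs h1 h2 h3
    by_contra! hc
    have cont : Continuous fun x => x + l x • w := by fun_prop
    obtain ⟨x, hx1, hxU, hx⟩ := near _ (hU.preimage cont) (by simpa [hlz] using hz)
    have hx0 : 0 ≤ l (x + l x • w) := by
      rw [shift]; exact mul_nonneg_of_nonpos_of_nonpos hx.le hc
    have h4 : h (x + l x • w) = h x := by
      rw [h1 ⟨hx1, hx0⟩, h2 ⟨hxU, hx⟩, h3]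
    have h5 : x + l x • w = x :=
      (hs _ hx1).symm.trans ((congrArg s h4).trans (hs x hxU))
    rw [h5] at hx0
    exact absurd hx hx0.not_gt
  have c1 := cpos hsg gF hG hu
  have c2 := cpos hsg' gF' hG' hu'
  set c := 1 + l.linear u with hc
  set c' := 1 + l.linear u' with hc'
  have cont : Continuous fun x => x + l x • (u - (c / c') • u') := by fun_prop
  obtain ⟨x, hx1, hxU, hx⟩ := near _ (hU.preimage cont) (by simpa [hlz] using hz)
  have hly : l (x + l x • (u - (c / c') • u')) = l x * (c / c') := by
    rw [shift, map_sub, map_smul, smul_eq_mul]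
    have e1 : l.linear u = c - 1 := by rw [hc]; ring
    have e2 : l.linear u' = c' - 1 := by rw [hc']; ring
    rw [e1, e2]
    field_simp
    ring
  have hy0 : l (x + l x • (u - (c / c') • u')) < 0 := by
    rw [hly]; exact mul_neg_of_neg_of_pos hx (div_pos c1 c2)
  have heq : g' (x + l x • (u - (c / c') • u')) = g x := by
    rw [hG' ⟨hx1, hy0⟩, hG ⟨hxU, hx⟩, hu, hu', hly]
    congr 1
    module
  have hxy : x + l x • (u - (c / c') • u') = x :=
    (hsg' _ hx1).symm.trans ((congrArg s heq).trans (hsg x hxU))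
  have hxu : u = (c / c') • u' := by
    simpa [hx.ne, sub_eq_zero] using hxy
  have hcc : c = c' := by
    have h1 : c - 1 = c / c' * (c' - 1) := by
      have := congrArg l.linear hxu
      rw [map_smul, smul_eq_mul] at this
      rw [hc, hc'] at *
      linarith
    field_simp at h1
    linarith
  have huu : u = u' := by
    rw [hxu, hcc, div_self c2.ne', one_smul]
  intro y hy
  rcases le_total 0 (l y) with h0 | h0
  · rw [gF ⟨hy, h0⟩, gF' ⟨hy, h0⟩]
  · rw [gG ⟨hy, h0⟩, gG' ⟨hy, h0⟩, hu, hu', huu]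

lemma isOpen_genericSet {Λ : Set (E →ᵃ[ℝ] ℝ)} (hΛ : Λ.Finite) : IsOpen (genericSet Λ) := by
  have : genericSet Λ = ⋂ l ∈ Λ, {x | l x ≠ 0} := by ext x; simp [genericSet]
  rw [this]
  exact hΛ.isOpen_biInter fun l _ =>
    isOpen_ne_fun l.continuous_of_finiteDimensional continuous_const

lemma ae_mem_genericSet [MeasurableSpace E] [BorelSpace E] (μ : Measure E) [μ.IsAddHaarMeasure]
    {Λ : Set (E →ᵃ[ℝ] ℝ)} (hΛ : Λ.Finite) (h0 : ∀ l ∈ Λ, l ≠ 0) :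
    ∀ᵐ x ∂μ, x ∈ genericSet Λ := by
  refine (ae_ball_iff hΛ.countable).2 fun l hl => ?_
  rw [ae_iff]
  let S : AffineSubspace ℝ E :=
    (AffineSubspace.mk' (0 : ℝ) (⊥ : Submodule ℝ ℝ)).comap l
  have hS : (S : Set E) = {x | ¬ l x ≠ 0} := by
    ext x
    simp [S, AffineSubspace.mem_mk']
  rw [← hS]
  refine Measure.addHaar_affineSubspace μ S fun htop => h0 l hl ?_
  ext x
  have hx : x ∈ (S : Set E) := by rw [htop]; trivial
  rw [hS] at hx
  simpa using hx

lemma dense_genericSet {Λ : Set (E →ᵃ[ℝ] ℝ)} (hΛ : Λ.Finite) (h0 : ∀ l ∈ Λ, l ≠ 0) :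
    Dense (genericSet Λ) := by
  borelize E
  exact Measure.dense_of_ae (ae_mem_genericSet Measure.addHaar hΛ h0)

/-- A piecewise affine function is affine on a connected set avoiding the separating
hyperplanes. -/
lemma exists_eqOn_of_isPreconnected {Λ : Set (E →ᵃ[ℝ] ℝ)} {L : Set (E →ᵃ[ℝ] E)}
    (hL : L.Finite) (hsep : Separates Λ L) {g : E → E} {C : Set E} (hC : IsPreconnected C)
    (hne : C.Nonempty) (hgen : C ⊆ genericSet Λ) (hg : ContinuousOn g C)
    (hpc : ∀ x ∈ C, ∃ A ∈ L, g x = A x) : ∃ A ∈ L, EqOn g A C := by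
  obtain ⟨p, hp⟩ := hne
  obtain ⟨A, hA, hpA⟩ := hpc p hp
  refine ⟨A, hA, ?_⟩
  have hcl : ∀ B : E →ᵃ[ℝ] E, IsClosed {x : C | g x = B x} := fun B =>
    isClosed_eq (continuousOn_iff_continuous_domRestrict.1 hg)
      (B.continuous_of_finiteDimensional.comp continuous_subtype_val)
  have hcompl : {x : C | g x = A x}ᶜ = ⋃ B ∈ L \ {A}, {x : C | g x = B x} := by
    ext x
    simp only [mem_compl_iff, mem_ofPred_eq, mem_iUnion, mem_sdiff, mem_singleton_iff,
      exists_prop]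
    constructor
    · intro hx
      obtain ⟨B, hB, hxB⟩ := hpc x x.2
      exact ⟨B, ⟨hB, fun h => hx (h ▸ hxB)⟩, hxB⟩
    · rintro ⟨B, ⟨hB, hBA⟩, hxB⟩ hxA
      exact hBA (hsep B hB A hA x (hgen x.2) (hxB.symm.trans hxA))
  have hclopen : IsClopen {x : C | g x = A x} := by
    refine ⟨hcl A, ?_⟩
    rw [← isClosed_compl_iff, hcompl]
    exact (hL.subset sdiff_subset).isClosed_biUnion fun B _ => hcl B
  have : PreconnectedSpace C := Subtype.preconnectedSpace hC
  have huniv := hclopen.eq_univ ⟨⟨p, hp⟩, hpA⟩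
  intro x hx
  have : (⟨x, hx⟩ : C) ∈ {x : C | g x = A x} := by rw [huniv]; trivial
  exact this

/-- On a ball centred on a hyperplane which contains all the non-generic points of the ball, two
sections of the same map agreeing on an open set on one side of the hyperplane coincide. -/
lemma eqOn_ball_of_proportional {Λ : Set (E →ᵃ[ℝ] ℝ)}
    {L : Set (E →ᵃ[ℝ] E)} (hL : L.Finite) (hsep : Separates Λ L) {g g' s : E → E}
    {z : E} {r : ℝ} (hr : 0 < r)
    (hg : ContinuousOn g (Metric.ball z r)) (hg' : ContinuousOn g' (Metric.ball z r))
    (hpc : ∀ x ∈ Metric.ball z r, ∃ A ∈ L, g x = A x)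
    (hpc' : ∀ x ∈ Metric.ball z r, ∃ A ∈ L, g' x = A x)
    (hsg : ∀ x ∈ Metric.ball z r, s (g x) = x) (hsg' : ∀ x ∈ Metric.ball z r, s (g' x) = x)
    {l : E →ᵃ[ℝ] ℝ} (hlz : l z = 0) {v : E} (hv : l.linear v = 1)
    (hl : ∀ x ∈ Metric.ball z r, l x ≠ 0 → x ∈ genericSet Λ)
    {W : Set E} (hW : IsOpen W) (hWne : W.Nonempty)
    (hWU : W ⊆ Metric.ball z r ∩ {x | 0 < l x}) (hgW : EqOn g g' W) :
    EqOn g g' (Metric.ball z r) := by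
  have conv : ∀ s : Set ℝ, Convex ℝ s → IsPreconnected (Metric.ball z r ∩ l ⁻¹' s) :=
    fun s hs => ((convex_ball z r).inter (hs.affine_preimage l)).isPreconnected
  have aux : ∀ {h : E → E} {s : Set ℝ}, Convex ℝ s → (0 : ℝ) ∉ s →
      (Metric.ball z r ∩ l ⁻¹' s).Nonempty → ContinuousOn h (Metric.ball z r) →
      (∀ x ∈ Metric.ball z r, ∃ A ∈ L, h x = A x) →
      ∃ A ∈ L, EqOn h A (Metric.ball z r ∩ l ⁻¹' s) := by
    intro h s hs h0 hne hh hp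
    exact exists_eqOn_of_isPreconnected hL hsep (conv s hs) hne
      (fun x hx => hl x hx.1 fun h => h0 (h ▸ hx.2)) (hh.mono inter_subset_left)
      fun x hx => hp x hx.1
  have hpos : (Metric.ball z r ∩ l ⁻¹' Ioi 0).Nonempty := hWne.mono hWU
  have hneg : (Metric.ball z r ∩ l ⁻¹' Iio 0).Nonempty := by
    obtain ⟨t, ht, hzt⟩ := exists_pos_add_smul_mem Metric.isOpen_ball
      (Metric.mem_ball_self (x := z) hr) (-v)
    refine ⟨_, hzt, ?_⟩
    simp only [mem_preimage, mem_Iio]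
    rw [l.apply_add_eq_real, map_smul, map_neg, hv, hlz]
    simpa using ht
  obtain ⟨F, -, hF⟩ := aux (convex_Ioi 0) (by simp) hpos hg hpc
  obtain ⟨F', -, hF'⟩ := aux (convex_Ioi 0) (by simp) hpos hg' hpc'
  obtain ⟨G, -, hG⟩ := aux (convex_Iio 0) (by simp) hneg hg hpc
  obtain ⟨G', -, hG'⟩ := aux (convex_Iio 0) (by simp) hneg hg' hpc'
  have hFF : F = F' := AffineMap.eq_of_eqOn_isOpen hW hWne fun x hx => by
    rw [← hF (hWU hx), ← hF' (hWU hx), hgW hx]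
  subst hFF
  exact eqOn_of_eqOn_halfspace Metric.isOpen_ball (Metric.mem_ball_self hr) hlz hv hg hg'
    hsg hsg' hF hF' hG hG'

/-- Two continuous piecewise affine sections of the same map over a connected open set coincide
as soon as they agree on a nonempty open subset. -/
theorem eqOn_of_eqOn_open_of_leftInverse {L : Set (E →ᵃ[ℝ] E)} {Λ : Set (E →ᵃ[ℝ] ℝ)}
    (hL : L.Finite) (hΛ : Λ.Finite) (h0 : ∀ l ∈ Λ, l ≠ 0) (hsep : Separates Λ L)
    {g g' s : E → E} {O : Set E} (hO : IsOpen O) (hOc : IsPreconnected O)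
    (hg : ContinuousOn g O) (hg' : ContinuousOn g' O)
    (hpc : ∀ x ∈ O, ∃ A ∈ L, g x = A x) (hpc' : ∀ x ∈ O, ∃ A ∈ L, g' x = A x)
    (hsg : ∀ x ∈ O, s (g x) = x) (hsg' : ∀ x ∈ O, s (g' x) = x)
    (hne : (interior {x ∈ O | g x = g' x}).Nonempty) : EqOn g g' O := by
  set V := interior {x ∈ O | g x = g' x} with hV
  have hVO : V ⊆ O := fun x hx => (interior_subset hx).1
  have hVe : EqOn g g' V := fun x hx => (interior_subset hx).2
  have hmem : ∀ z r, 0 < r → Metric.ball z r ⊆ O → EqOn g g' (Metric.ball z r) → z ∈ V :=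
    fun z r hr hB he => mem_interior.2
      ⟨_, fun x hx => ⟨hB hx, he hx⟩, Metric.isOpen_ball, Metric.mem_ball_self hr⟩
  suffices hsub : O ⊆ V from hVe.mono hsub
  obtain ⟨p₀, hp₀⟩ := hne
  refine hOc.subset_of_closure_inter_subset isOpen_interior ⟨p₀, hVO hp₀, hp₀⟩ ?_
  rintro x ⟨hxcl, hxO⟩
  obtain ⟨r, hr, hball⟩ := Metric.isOpen_iff.1 hO x hxO
  refine hmem x r hr hball ?_
  obtain ⟨p', hp'1, hp'2⟩ := mem_closure_iff.1 hxcl _ Metric.isOpen_ball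
    (Metric.mem_ball_self (x := x) hr)
  obtain ⟨p, ⟨hpB, hpV⟩, hpgen⟩ := (dense_genericSet hΛ h0).inter_open_nonempty _
    (Metric.isOpen_ball.inter isOpen_interior) ⟨p', hp'1, hp'2⟩
  set Δ : Set (E →ᵃ[ℝ] ℝ) :=
    (image2 (fun a b : E →ᵃ[ℝ] ℝ => a p • b - b p • a) Λ Λ) \ {0} with hΔ
  have hΔfin : Δ.Finite := (hΛ.image2 _ hΛ).subset sdiff_subset
  have hΔ0 : ∀ l ∈ Δ, l ≠ 0 := fun l hl => hl.2
  have hdense := dense_genericSet hΔfin hΔ0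
  suffices hq : ∀ q ∈ Metric.ball x r ∩ genericSet Δ, q ∈ V by
    have hs : Metric.ball x r ∩ genericSet Δ ⊆ Metric.ball x r := inter_subset_left
    exact EqOn.of_subset_closure (fun q h => hVe (hq q h)) (hg.mono hball) (hg'.mono hball) hs
      (hdense.open_subset_closure_inter Metric.isOpen_ball)
  rintro q ⟨hqB, hqgen⟩
  have hsegB : segment ℝ p q ⊆ Metric.ball x r := (convex_ball x r).segment_subset hpB hqB
  suffices hseg : segment ℝ p q ⊆ V from hseg (right_mem_segment ℝ p q)
  refine (convex_segment p q).isPreconnected.subset_of_closure_inter_subset isOpen_interior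
    ⟨p, left_mem_segment ℝ p q, hpV⟩ ?_
  rintro z ⟨hzcl, hz⟩
  have hzO := hball (hsegB hz)
  have hopen : IsOpen (O ∩ genericSet {l ∈ Λ | l z ≠ 0}) :=
    hO.inter (isOpen_genericSet (hΛ.subset (sep_subset _ _)))
  obtain ⟨ρ, hρ, hρsub⟩ := Metric.isOpen_iff.1 hopen z ⟨hzO, fun l hl => hl.2⟩
  have hρO : Metric.ball z ρ ⊆ O := fun y hy => (hρsub hy).1
  refine hmem z ρ hρ hρO ?_
  obtain ⟨w, hwB, hwV⟩ := mem_closure_iff.1 hzcl _ Metric.isOpen_ball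
    (Metric.mem_ball_self (x := z) hρ)
  have hgB := hg.mono hρO
  have hgB' := hg'.mono hρO
  by_cases hcase : ∃ a ∈ Λ, a z = 0
  · obtain ⟨a, ha, haz⟩ := hcase
    have hap : a p ≠ 0 := hpgen a ha
    have hprop : ∀ b ∈ Λ, b z = 0 → a p • b = b p • a := by
      intro b hb hbz
      by_contra hne
      have hmemΔ : a p • b - b p • a ∈ Δ := ⟨⟨a, ha, b, hb, rfl⟩, fun h => hne (sub_eq_zero.1 h)⟩
      refine hqgen _ hmemΔ ?_
      rw [segment_eq_image_lineMap] at hz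
      obtain ⟨t, -, rfl⟩ := hz
      rw [AffineMap.apply_lineMap, AffineMap.lineMap_apply_ring'] at haz hbz
      have ht : t ≠ 0 := by
        rintro rfl
        simp [hap] at haz
      have : t * (a p * b q - b p * a q) = 0 := by linear_combination a p * hbz - b p * haz
      simpa [ht] using this
    have hgen : ∀ y ∈ Metric.ball z ρ, a y ≠ 0 → y ∈ genericSet Λ := by
      intro y hy hay b hb hby
      by_cases hbz : b z = 0
      · have h1 := hprop b hb hbz
        have h2 := congrArg (fun f : E →ᵃ[ℝ] ℝ => f y) h1
        simp only [AffineMap.coe_smul, Pi.smul_apply, smul_eq_mul, hby, mul_zero] at h2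
        have hbp : b p ≠ 0 := hpgen b hb
        simp [hbp, hay] at h2
      · exact (hρsub hy).2 b ⟨hb, hbz⟩ hby
    have hlin : a.linear (p - z) = a p := by
      have := a.apply_add_eq_real z (p - z)
      rw [haz, zero_add, add_sub_cancel] at this
      exact this.symm
    obtain ⟨w', ⟨hw'V, hw'B⟩, hw'gen⟩ := (dense_genericSet hΛ h0).inter_open_nonempty _
      (isOpen_interior.inter Metric.isOpen_ball) ⟨w, hwV, hwB⟩
    have hca : Continuous a := a.continuous_of_finiteDimensional
    rcases lt_or_gt_of_ne (hw'gen a ha) with hlt | hgt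
    · refine eqOn_ball_of_proportional (l := -a) (v := -((a p)⁻¹ • (p - z)))
        (W := V ∩ (Metric.ball z ρ ∩ {y | 0 < (-a) y})) hL hsep hρ hgB hgB'
        (fun y hy => hpc y (hρO hy)) (fun y hy => hpc' y (hρO hy)) (fun y hy => hsg y (hρO hy))
        (fun y hy => hsg' y (hρO hy)) (by simp [haz]) ?_ ?_
        (isOpen_interior.inter (Metric.isOpen_ball.inter ?_)) ⟨w', hw'V, hw'B, by simpa using hlt⟩
        inter_subset_right (hVe.mono inter_subset_left)
      · simp [hlin, hap]
      · intro y hy h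
        exact hgen y hy (by simpa using h)
      · exact isOpen_lt continuous_const (by simpa using hca.neg)
    · refine eqOn_ball_of_proportional (l := a) (v := (a p)⁻¹ • (p - z))
        (W := V ∩ (Metric.ball z ρ ∩ {y | 0 < a y})) hL hsep hρ hgB hgB'
        (fun y hy => hpc y (hρO hy)) (fun y hy => hpc' y (hρO hy)) (fun y hy => hsg y (hρO hy))
        (fun y hy => hsg' y (hρO hy)) haz ?_ hgen
        (isOpen_interior.inter (Metric.isOpen_ball.inter (isOpen_lt continuous_const hca)))
        ⟨w', hw'V, hw'B, hgt⟩ inter_subset_right (hVe.mono inter_subset_left)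
      rw [map_smul, hlin, smul_eq_mul, inv_mul_cancel₀ hap]
  · have hgen : Metric.ball z ρ ⊆ genericSet Λ := fun y hy l hl =>
      (hρsub hy).2 l ⟨hl, fun h => hcase ⟨l, hl, h⟩⟩
    have hc := (convex_ball z ρ).isPreconnected
    have hBne : (Metric.ball z ρ).Nonempty := ⟨z, Metric.mem_ball_self hρ⟩
    obtain ⟨F, -, hF⟩ := exists_eqOn_of_isPreconnected hL hsep hc hBne hgen hgB
      fun y hy => hpc y (hρO hy)
    obtain ⟨F', -, hF'⟩ := exists_eqOn_of_isPreconnected hL hsep hc hBne hgen hgB'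
      fun y hy => hpc' y (hρO hy)
    have hFF : F = F' := AffineMap.eq_of_eqOn_isOpen (Metric.isOpen_ball.inter isOpen_interior)
      ⟨w, hwB, hwV⟩ fun y hy => by rw [← hF hy.1, ← hF' hy.1, hVe hy.2]
    intro y hy
    rw [hF hy, hF' hy, hFF]

/-- The coincidence set of two piecewise affine maps is null when it has empty interior. -/
lemma measure_eqLocus_eq_zero [MeasurableSpace E] [BorelSpace E] (μ : Measure E)
    [μ.IsAddHaarMeasure] {L : Set (E →ᵃ[ℝ] E)} {Λ : Set (E →ᵃ[ℝ] ℝ)}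
    (hL : L.Finite) (hΛ : Λ.Finite) (h0 : ∀ l ∈ Λ, l ≠ 0) (hsep : Separates Λ L)
    {g g' : E → E} {O : Set E} (hO : IsOpen O)
    (hg : ContinuousOn g O) (hg' : ContinuousOn g' O)
    (hpc : ∀ x ∈ O, ∃ A ∈ L, g x = A x) (hpc' : ∀ x ∈ O, ∃ A ∈ L, g' x = A x)
    (hempty : ¬ (interior {x ∈ O | g x = g' x}).Nonempty) :
    μ {x ∈ O | g x = g' x} = 0 := by
  refine measure_mono_null (t := {x | ¬ x ∈ genericSet Λ}) (fun x hx hgen => hempty ?_)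
    (ae_iff.1 (ae_mem_genericSet μ hΛ h0))
  obtain ⟨r, hr, hball⟩ := Metric.isOpen_iff.1 (hO.inter (isOpen_genericSet hΛ)) x ⟨hx.1, hgen⟩
  have hB : Metric.ball x r ⊆ O := fun y hy => (hball hy).1
  have hBg : Metric.ball x r ⊆ genericSet Λ := fun y hy => (hball hy).2
  have hc := (convex_ball x r).isPreconnected
  have hxB := Metric.mem_ball_self (x := x) hr
  obtain ⟨F, hFL, hF⟩ := exists_eqOn_of_isPreconnected hL hsep hc ⟨x, hxB⟩ hBg (hg.mono hB)
    fun y hy => hpc y (hB hy)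
  obtain ⟨F', hFL', hF'⟩ := exists_eqOn_of_isPreconnected hL hsep hc ⟨x, hxB⟩ hBg (hg'.mono hB)
    fun y hy => hpc' y (hB hy)
  have hFF := hsep F hFL F' hFL' x hgen (by rw [← hF hxB, ← hF' hxB, hx.2])
  exact ⟨x, mem_interior.2 ⟨_, fun y hy => ⟨hB hy, by rw [hF hy, hF' hy, hFF]⟩,
    Metric.isOpen_ball, hxB⟩⟩

lemma AffineMap.hasFDerivAt_linear (A : E →ᵃ[ℝ] E) (x : E) :
    HasFDerivAt A (LinearMap.toContinuousLinearMap A.linear) x := by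
  have h : (A : E → E) = fun y => LinearMap.toContinuousLinearMap A.linear y + A 0 := by
    ext y
    exact congrFun A.decomp y
  rw [h]
  exact (LinearMap.toContinuousLinearMap A.linear).hasFDerivAt.add_const _

lemma measure_image_eq_zero_of_piecewise [MeasurableSpace E] [BorelSpace E] (μ : Measure E)
    [μ.IsAddHaarMeasure] {L : Set (E →ᵃ[ℝ] E)} (hL : L.Finite) {g : E → E} {N : Set E}
    (hpc : ∀ x ∈ N, ∃ A ∈ L, g x = A x) (hN : μ N = 0) : μ (g '' N) = 0 := by
  have hsub : g '' N ⊆ ⋃ A ∈ L, A '' N := by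
    rintro _ ⟨x, hx, rfl⟩
    obtain ⟨A, hA, hxA⟩ := hpc x hx
    exact mem_biUnion hA ⟨x, hx, hxA.symm⟩
  refine measure_mono_null hsub ((measure_biUnion_null_iff hL.countable).2 fun A _ => ?_)
  exact addHaar_image_eq_zero_of_differentiableOn_of_addHaar_eq_zero μ
    (fun x _ => (A.hasFDerivAt_linear x).differentiableAt.differentiableWithinAt) hN

/-- An injective piecewise affine map whose invertible pieces have determinant at least one in
absolute value does not decrease the measure of open sets. -/
lemma measure_le_measure_image_of_piecewise [MeasurableSpace E] [BorelSpace E] (μ : Measure E)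
    [μ.IsAddHaarMeasure] {L : Set (E →ᵃ[ℝ] E)} {Λ : Set (E →ᵃ[ℝ] ℝ)}
    (hL : L.Finite) (hΛ : Λ.Finite) (h0 : ∀ l ∈ Λ, l ≠ 0) (hsep : Separates Λ L)
    (hdet : ∀ A ∈ L, Function.Injective A.linear → 1 ≤ |LinearMap.det A.linear|)
    {g : E → E} {O : Set E} (hO : IsOpen O) (hg : ContinuousOn g O)
    (hpc : ∀ x ∈ O, ∃ A ∈ L, g x = A x) (hinj : InjOn g O) : μ O ≤ μ (g '' O) := by
  set S := O ∩ genericSet Λ with hS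
  have hSo : IsOpen S := hO.inter (isOpen_genericSet hΛ)
  have hloc : ∀ x ∈ S, ∃ f : E →L[ℝ] E, HasFDerivAt g f x ∧ 1 ≤ |f.det| := by
    intro x hx
    obtain ⟨r, hr, hball⟩ := Metric.isOpen_iff.1 hSo x hx
    have hB : Metric.ball x r ⊆ O := fun y hy => (hball hy).1
    have hxB := Metric.mem_ball_self (x := x) hr
    obtain ⟨F, hFL, hF⟩ := exists_eqOn_of_isPreconnected hL hsep (convex_ball x r).isPreconnected
      ⟨x, hxB⟩ (fun y hy => (hball hy).2) (hg.mono hB) fun y hy => hpc y (hB hy)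
    refine ⟨_, (F.hasFDerivAt_linear x).congr_of_eventuallyEq
      (hF.eventuallyEq_of_mem (Metric.isOpen_ball.mem_nhds hxB)), ?_⟩
    rw [LinearMap.det_toContinuousLinearMap]
    exact hdet F hFL (AffineMap.linear_injective_of_injOn Metric.isOpen_ball ⟨x, hxB⟩
      ((hinj.mono hB).congr hF))
  choose! f hf hfdet using hloc
  calc μ O ≤ μ S := measure_mono_ae <| by
        filter_upwards [ae_mem_genericSet μ hΛ h0] with x hx hxO using ⟨hxO, hx⟩
    _ = ∫⁻ _ in S, 1 ∂μ := by simp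
    _ ≤ ∫⁻ x in S, ENNReal.ofReal |(f x).det| ∂μ := by
        refine setLIntegral_mono' hSo.measurableSet fun x hx => ?_
        rw [← ENNReal.ofReal_one]
        exact ENNReal.ofReal_le_ofReal (hfdet x hx)
    _ = μ (g '' S) := lintegral_abs_det_fderiv_eq_addHaar_image μ hSo.measurableSet
        (fun x hx => (hf x hx).hasFDerivWithinAt) (hinj.mono inter_subset_left)
    _ ≤ μ (g '' O) := measure_mono (image_mono inter_subset_left)

/-- The images of connected open sets under two piecewise affine sections of the same map either
coincide or overlap in a null set. -/
lemma image_eq_or_aedisjoint [MeasurableSpace E] [BorelSpace E] (μ : Measure E)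
    [μ.IsAddHaarMeasure] {L : Set (E →ᵃ[ℝ] E)} {Λ : Set (E →ᵃ[ℝ] ℝ)}
    (hL : L.Finite) (hΛ : Λ.Finite) (h0 : ∀ l ∈ Λ, l ≠ 0) (hsep : Separates Λ L)
    {g g' s : E → E} {O : Set E} (hO : IsOpen O) (hOc : IsPreconnected O)
    (hg : ContinuousOn g O) (hg' : ContinuousOn g' O)
    (hpc : ∀ x ∈ O, ∃ A ∈ L, g x = A x) (hpc' : ∀ x ∈ O, ∃ A ∈ L, g' x = A x)
    (hsg : ∀ x ∈ O, s (g x) = x) (hsg' : ∀ x ∈ O, s (g' x) = x) :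
    g '' O = g' '' O ∨ AEDisjoint μ (g '' O) (g' '' O) := by
  by_cases hne : (interior {x ∈ O | g x = g' x}).Nonempty
  · exact Or.inl (eqOn_of_eqOn_open_of_leftInverse hL hΛ h0 hsep hO hOc hg hg' hpc hpc' hsg hsg'
      hne).image_eq
  · right
    have hnull := measure_eqLocus_eq_zero μ hL hΛ h0 hsep hO hg hg' hpc hpc' hne
    refine measure_mono_null ?_ (measure_image_eq_zero_of_piecewise μ hL
      (fun x hx => hpc x hx.1) hnull)
    rintro _ ⟨⟨x, hx, rfl⟩, ⟨x', hx', hxx'⟩⟩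
    have : x' = x := by rw [← hsg' x' hx', hxx', hsg x hx]
    subst this
    exact ⟨x', ⟨hx, hxx'.symm⟩, rfl⟩

/-- The interior of the fixed point set of a piecewise affine map of a convex set has finitely
many connected components. -/
lemma finite_components_interior_fixedPoints {L : Set (E →ᵃ[ℝ] E)} {Λ : Set (E →ᵃ[ℝ] ℝ)}
    (hL : L.Finite) (hΛ : Λ.Finite) (h0 : ∀ l ∈ Λ, l ≠ 0) (hsep : Separates Λ L)
    (hid : AffineMap.id ℝ E ∈ L) {K P : Set E} (hK : Convex ℝ K) {f : E → E}
    (hf : ContinuousOn f K) (hpc : ∀ x ∈ K, ∃ A ∈ L, f x = A x)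
    (hP : P = {x ∈ K | f x = x}) :
    (connectedComponentIn (interior P) '' interior P).Finite := by
  have hPK : interior P ⊆ interior K := interior_mono (hP ▸ sep_subset _ _)
  have hcell : ∀ x ∈ interior P ∩ genericSet Λ, ∀ y ∈ interior P ∩ genericSet Λ,
      (∀ l ∈ Λ, 0 < l x ↔ 0 < l y) →
      connectedComponentIn (interior P) x = connectedComponentIn (interior P) y := by
    rintro x ⟨hx, hxg⟩ y ⟨hy, hyg⟩ hxy
    have hset : {w | ∀ l ∈ Λ, 0 < l x * l w} = ⋂ l ∈ Λ, {w | 0 < l x * l w} := by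
      ext w; simp
    set C := interior K ∩ {w | ∀ l ∈ Λ, 0 < l x * l w} with hC
    have hCo : IsOpen C := by
      refine isOpen_interior.inter ?_
      rw [hset]
      exact hΛ.isOpen_biInter fun l _ => isOpen_lt continuous_const
        (continuous_const.mul l.continuous_of_finiteDimensional)
    have hCc : Convex ℝ C := by
      refine hK.interior.inter ?_
      rw [hset]
      exact convex_iInter₂ fun l _ => (convex_Ioi (0 : ℝ)).affine_preimage (l x • l)
    have hxC : x ∈ C := ⟨hPK hx, fun l hl => mul_self_pos.2 (hxg l hl)⟩
    have hyC : y ∈ C := by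
      refine ⟨hPK hy, fun l hl => ?_⟩
      rcases lt_or_gt_of_ne (hxg l hl) with h | h
      · exact mul_pos_of_neg_of_neg h (lt_of_le_of_ne
          (not_lt.1 fun h' => h.not_gt ((hxy l hl).2 h')) (hyg l hl))
      · exact mul_pos h ((hxy l hl).1 h)
    have hCK : C ⊆ K := fun w hw => interior_subset hw.1
    have hCg : C ⊆ genericSet Λ := fun w hw l hl h => by
      have := hw.2 l hl
      simp [h] at this
    obtain ⟨A, hA, hfA⟩ := exists_eqOn_of_isPreconnected hL hsep hCc.isPreconnected ⟨x, hxC⟩ hCg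
      (hf.mono hCK) fun w hw => hpc w (hCK hw)
    have hfx : f x = x := by
      have := interior_subset hx
      rw [hP] at this
      exact this.2
    have hAid : A = AffineMap.id ℝ E := hsep A hA _ hid x hxg (by rw [← hfA hxC, hfx]; rfl)
    have hCP : C ⊆ interior P := by
      refine interior_maximal (fun w hw => ?_) hCo
      rw [hP]
      exact ⟨hCK hw, by rw [hfA hw, hAid]; rfl⟩
    exact connectedComponentIn_eq
      (hCc.isPreconnected.subset_connectedComponentIn hxC hCP hyC)
  have hrep : ∀ C ∈ connectedComponentIn (interior P) '' interior P,
      ∃ x ∈ interior P ∩ genericSet Λ, C = connectedComponentIn (interior P) x := by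
    rintro _ ⟨x, hx, rfl⟩
    obtain ⟨y, hy, hyg⟩ := (dense_genericSet hΛ h0).inter_open_nonempty _
      (isOpen_interior (s := P)).connectedComponentIn ⟨x, mem_connectedComponentIn hx⟩
    exact ⟨y, ⟨connectedComponentIn_subset _ _ hy, hyg⟩, connectedComponentIn_eq hy⟩
  choose! p hp hpC using hrep
  have : Finite Λ := hΛ
  refine Set.Finite.of_finite_image (f := fun C => fun l : Λ => (0 < l.1 (p C))) (toFinite _) ?_
  intro C hC C' hC' h
  rw [hpC C hC, hpC C' hC']
  exact hcell _ (hp C hC) _ (hp C' hC') fun l hl => iff_of_eq (congrFun h ⟨l, hl⟩)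

end PiecewiseAffine

lemma exists_separating_functionals {n : ℕ} {L : Set ((Fin n → ℝ) →ᵃ[ℝ] (Fin n → ℝ))}
    (hL : L.Finite) : ∃ Λ : Set ((Fin n → ℝ) →ᵃ[ℝ] ℝ),
      Λ.Finite ∧ (∀ l ∈ Λ, l ≠ 0) ∧ Separates Λ L := by
  let coord : Fin n → ((Fin n → ℝ) →ᵃ[ℝ] ℝ) := fun i =>
    (LinearMap.proj (R := ℝ) (φ := fun _ : Fin n => ℝ) i).toAffineMap
  let T : Set ((Fin n → ℝ) →ᵃ[ℝ] ℝ) :=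
    ⋃ i, image2 (fun A B => (coord i).comp (A - B)) L L
  have hT : T.Finite := finite_iUnion fun i => hL.image2 _ hL
  refine ⟨T \ {0}, hT.subset sdiff_subset, fun l hl => hl.2, ?_⟩
  intro A hA B hB x hx hAB
  by_contra hne
  have hex : ∃ i, (coord i).comp (A - B) ≠ 0 := by
    by_contra! hall
    refine hne ?_
    ext y i
    have := congrArg (fun f : (Fin n → ℝ) →ᵃ[ℝ] ℝ => f y) (hall i)
    simpa [coord, sub_eq_zero] using this
  obtain ⟨i, hi⟩ := hex
  refine hx _ ⟨mem_iUnion.2 ⟨i, A, hA, B, hB, rfl⟩, hi⟩ ?_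
  simp [coord, hAB]

lemma IsIntAffine.exists_affineMap {n : ℕ} {g : (Fin n → ℝ) → (Fin n → ℝ)}
    (hg : IsIntAffine g) : ∃ A : (Fin n → ℝ) →ᵃ[ℝ] (Fin n → ℝ), (∀ x, g x = A x) ∧
      (Function.Injective A.linear → 1 ≤ |LinearMap.det A.linear|) := by
  obtain ⟨M, b, hMb⟩ := hg
  let N : Matrix (Fin n) (Fin n) ℤ := Matrix.of M
  let f : (Fin n → ℝ) →ₗ[ℝ] (Fin n → ℝ) := Matrix.toLin' (N.map (Int.cast : ℤ → ℝ))
  refine ⟨f.toAffineMap + AffineMap.const ℝ _ (fun i => (b i : ℝ)), fun x => ?_, ?_⟩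
  · ext i
    rw [hMb]
    simp [f, N, Matrix.mulVec, dotProduct]
  · intro hinj
    have hlin : (f.toAffineMap + AffineMap.const ℝ (Fin n → ℝ) (fun i => (b i : ℝ))).linear = f := by
      simp
    rw [hlin] at hinj ⊢
    have hdet : LinearMap.det f = ((N.det : ℤ) : ℝ) := by
      simp only [f, LinearMap.det_toLin']
      exact (Int.cast_det N).symm
    have h0 : LinearMap.det f ≠ 0 :=
      (LinearEquiv.isUnit_det' (LinearEquiv.ofInjectiveEndo f hinj)).ne_zero
    rw [hdet] at h0 ⊢
    have hN : N.det ≠ 0 := by exact_mod_cast h0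
    exact_mod_cast Int.one_le_abs hN

lemma IsZMapOn.exists_affineMaps {n : ℕ} {P : Set (Fin n → ℝ)} {f : (Fin n → ℝ) → (Fin n → ℝ)}
    (hf : IsZMapOn P f) : ∃ L : Set ((Fin n → ℝ) →ᵃ[ℝ] (Fin n → ℝ)), L.Finite ∧
      (∀ A ∈ L, Function.Injective A.linear → 1 ≤ |LinearMap.det A.linear|) ∧
      ∀ x ∈ P, ∃ A ∈ L, f x = A x := by
  obtain ⟨-, k, g, hg, hfg⟩ := hf
  choose A hA hdet using fun i => (hg i).exists_affineMap
  refine ⟨range A, finite_range A, ?_, fun x hx => ?_⟩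
  · rintro _ ⟨i, rfl⟩
    exact hdet i
  · obtain ⟨i, hi⟩ := hfg x hx
    exact ⟨A i, mem_range_self i, by rw [hi, hA]⟩

lemma volume_cubeSet (n : ℕ) : volume (cubeSet n) = 1 := by
  simp [cubeSet, Real.volume_Icc_pi]

/-- A family of almost disjoint sets of measure at least `c` in a set of measure at most one has
at most `⌊1 / c⌋` members. -/
lemma finite_and_ncard_le_of_aedisjoint {α : Type*} [MeasurableSpace α] {μ : Measure α}
    {K : Set α} (hK : μ K ≤ 1) {c : ℝ} (hc : 0 < c) {S : Set (Set α)}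
    (hmeas : ∀ t ∈ S, MeasurableSet t) (hsub : ∀ t ∈ S, t ⊆ K)
    (hdisj : S.Pairwise (AEDisjoint μ)) (hle : ∀ t ∈ S, ENNReal.ofReal c ≤ μ t) :
    S.Finite ∧ S.ncard ≤ ⌊1 / c⌋₊ := by
  have hcard : ∀ s : Finset (Set α), (s : Set (Set α)) ⊆ S → s.card ≤ ⌊1 / c⌋₊ := by
    intro s hs
    have h1 := sum_measure_le_measure_univ (μ := μ.restrict K) (s := s) (t := id)
      (fun t ht => (hmeas t (hs ht)).nullMeasurableSet)
      fun t ht u hu htu => nonpos_iff_eq_zero.1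
        ((Measure.restrict_apply_le _ _).trans (hdisj (hs ht) (hs hu) htu).le)
    have h2 : (s.card : ENNReal) * ENNReal.ofReal c ≤ 1 := by
      calc (s.card : ENNReal) * ENNReal.ofReal c = ∑ _t ∈ s, ENNReal.ofReal c := by simp
        _ ≤ ∑ t ∈ s, (μ.restrict K) (id t) := Finset.sum_le_sum fun t ht => by
            rw [id, Measure.restrict_eq_self μ (hsub t (hs ht))]
            exact hle t (hs ht)
        _ ≤ 1 := by
            rw [Measure.restrict_apply_univ] at h1
            exact h1.trans hK
    have h3 : (s.card : ℝ) * c ≤ 1 := by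
      rw [← ENNReal.ofReal_natCast, ← ENNReal.ofReal_mul (by positivity),
        ENNReal.ofReal_le_one] at h2
      exact h2
    exact Nat.le_floor ((le_div_iff₀ hc).2 h3)
  have hfin : S.Finite := by
    by_contra hinf
    obtain ⟨s, hs, hcs⟩ := Set.Infinite.exists_subset_card_eq hinf (⌊1 / c⌋₊ + 1)
    have := hcard s hs
    omega
  refine ⟨hfin, ?_⟩
  rw [ncard_eq_toFinset_card S hfin]
  exact hcard _ (by simp)

/-- A set that injects into the `k`-element subsets of a finite set `S` has at most
`S.ncard.choose k` elements. -/
lemma finite_and_ncard_le_choose {α β : Type*} {D : Set α} {S : Set β} {k : ℕ} (hS : S.Finite)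
    (f : α → Set β) (hinj : InjOn f D) (hsub : ∀ a ∈ D, f a ⊆ S) (hk : ∀ a ∈ D, (f a).ncard = k) :
    D.Finite ∧ D.ncard ≤ S.ncard.choose k := by
  classical
  let T : Set (Set β) := (fun s : Finset β => (s : Set β)) '' (hS.toFinset.powersetCard k : Set _)
  have hT : T.Finite := (Finset.finite_toSet _).image _
  have hmaps : ∀ a ∈ D, f a ∈ T := fun a ha => by
    have hfa : (f a).Finite := hS.subset (hsub a ha)
    refine ⟨hfa.toFinset, ?_, by simp⟩
    rw [Finset.mem_coe, Finset.mem_powersetCard, ← ncard_eq_toFinset_card _ hfa]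
    exact ⟨by simpa using hsub a ha, hk a ha⟩
  refine ⟨Set.Finite.of_injOn hmaps hinj hT, (ncard_le_ncard_of_injOn f hmaps hinj hT).trans ?_⟩
  rw [ncard_eq_toFinset_card S hS, ← Finset.card_powersetCard]
  exact (ncard_image_le (Finset.finite_toSet _)).trans (ncard_coe_finset _).le

lemma cubeSet_convex (n : ℕ) : Convex ℝ (cubeSet n) := convex_Icc 0 1

lemma zRange_eq_fixedPoints {n : ℕ} {σ : (Fin n → ℝ) → (Fin n → ℝ)} (hσ : IsZRetraction σ) :
    zRange σ = {x ∈ cubeSet n | σ x = x} := by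
  ext x
  constructor
  · rintro ⟨y, hy, rfl⟩
    exact ⟨hσ.2.1 hy, hσ.2.2 y hy⟩
  · rintro ⟨hx, hxx⟩
    exact ⟨x, hx, hxx⟩

lemma IsZRetraction.finite_components {n : ℕ} {σ : (Fin n → ℝ) → (Fin n → ℝ)}
    (hσ : IsZRetraction σ) :
    (connectedComponentIn (interior (zRange σ)) '' interior (zRange σ)).Finite := by
  obtain ⟨L, hL, -, hpc⟩ := hσ.1.exists_affineMaps
  have hL' : (insert (AffineMap.id ℝ (Fin n → ℝ)) L).Finite := hL.insert _
  obtain ⟨Λ, hΛ, h0, hsep⟩ := exists_separating_functionals hL'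
  refine finite_components_interior_fixedPoints hL' hΛ h0 hsep (mem_insert _ _)
    (cubeSet_convex n) hσ.1.1 (fun x hx => ?_) (zRange_eq_fixedPoints hσ)
  obtain ⟨A, hA, h⟩ := hpc x hx
  exact ⟨A, mem_insert_of_mem _ hA, h⟩

lemma IsZRetraction.isCompact_zRange {n : ℕ} {σ : (Fin n → ℝ) → (Fin n → ℝ)}
    (hσ : IsZRetraction σ) : IsCompact (zRange σ) :=
  isCompact_Icc.image_of_continuousOn hσ.1.1

/-- A Z-homeomorphism domain for `σ` is determined by the images of the components of the interior
of the range under the inverse of `σ`, which bounds the number of such domains. -/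
lemma card_zHomeoDomains_le {n : ℕ} {σ : (Fin n → ℝ) → (Fin n → ℝ)} (hσ : IsZRetraction σ)
    (hcd : IsClosedDomain (zRange σ)) {k : ℕ} {O : Fin k → Set (Fin n → ℝ)}
    (hinj : Function.Injective O) (hopen : ∀ i, IsOpen (O i)) (hconn : ∀ i, IsPreconnected (O i))
    (hdisj : ∀ i j, i ≠ j → Disjoint (O i) (O j))
    (hunion : ⋃ i, O i = interior (zRange σ)) {c : ℝ} (hc : 0 < c)
    (hvol : ∀ i, ENNReal.ofReal c ≤ volume (O i)) :
    {Q | IsZHomeoDomain σ Q}.Finite ∧ {Q | IsZHomeoDomain σ Q}.ncard ≤ ⌊1 / c⌋₊.choose k := by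
  set D := {Q | IsZHomeoDomain σ Q} with hD
  have hOP : ∀ i, O i ⊆ zRange σ := fun i =>
    (subset_iUnion O i).trans (hunion.subset.trans interior_subset)
  have hex : ∀ Q ∈ D, ∃ g : (Fin n → ℝ) → (Fin n → ℝ), IsZMapOn (zRange σ) g ∧
      (∀ y ∈ zRange σ, σ (g y) = y) ∧ g '' zRange σ = Q := by
    rintro Q ⟨-, -, -, hQ, -, g, hg, hgl, hgr⟩
    refine ⟨g, hg, hgr, ?_⟩
    rw [← hQ, ← image_comp]
    exact (image_congr hgl).trans (image_id Q)
  choose! g hgZ hgr hgQ using hex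
  have hDc : ∀ Q ∈ D, Q ⊆ cubeSet n := fun Q hQ => hQ.2.1
  have hgc : ∀ Q ∈ D, ∀ i, ContinuousOn (g Q) (O i) := fun Q hQ i => (hgZ Q hQ).1.mono (hOP i)
  have hgi : ∀ Q ∈ D, ∀ i, InjOn (g Q) (O i) := fun Q hQ i x hx y hy hxy => by
    rw [← hgr Q hQ x (hOP i hx), ← hgr Q hQ y (hOP i hy), hxy]
  have hσg : ∀ Q ∈ D, ∀ i, σ '' (g Q '' O i) = O i := fun Q hQ i => by
    rw [← image_comp]
    exact (image_congr fun x hx => hgr Q hQ x (hOP i hx)).trans (image_id _)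
  let F : Set (Set (Fin n → ℝ)) := {t | ∃ Q ∈ D, ∃ i, g Q '' O i = t}
  have hF : F.Finite ∧ F.ncard ≤ ⌊1 / c⌋₊ := by
    refine finite_and_ncard_le_of_aedisjoint (μ := volume) (K := cubeSet n)
      (volume_cubeSet n).le hc ?_ ?_ ?_ ?_
    · rintro _ ⟨Q, hQ, i, rfl⟩
      exact (hopen i).measurableSet.image_of_continuousOn_injOn (hgc Q hQ i) (hgi Q hQ i)
    · rintro _ ⟨Q, hQ, i, rfl⟩
      exact (image_mono (hOP i)).trans ((hgQ Q hQ).subset.trans (hDc Q hQ))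
    · rintro _ ⟨Q, hQ, i, rfl⟩ _ ⟨Q', hQ', j, rfl⟩ hne
      by_cases hij : i = j
      · subst hij
        obtain ⟨L, hL, -, hpc⟩ := (hgZ Q hQ).exists_affineMaps
        obtain ⟨L', hL', -, hpc'⟩ := (hgZ Q' hQ').exists_affineMaps
        obtain ⟨Λ, hΛ, h0, hsep⟩ := exists_separating_functionals (hL.union hL')
        refine (image_eq_or_aedisjoint volume (hL.union hL') hΛ h0 hsep (s := σ) (hopen i)
          (hconn i) (hgc Q hQ i) (hgc Q' hQ' i) (fun x hx => ?_) (fun x hx => ?_)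
          (fun x hx => hgr Q hQ x (hOP i hx)) fun x hx => hgr Q' hQ' x (hOP i hx)).resolve_left hne
        · obtain ⟨A, hA, h⟩ := hpc x (hOP i hx)
          exact ⟨A, Or.inl hA, h⟩
        · obtain ⟨A, hA, h⟩ := hpc' x (hOP i hx)
          exact ⟨A, Or.inr hA, h⟩
      · refine Disjoint.aedisjoint (Disjoint.of_image (f := σ) ?_)
        rw [hσg Q hQ, hσg Q' hQ']
        exact hdisj i j hij
    · rintro _ ⟨Q, hQ, i, rfl⟩
      obtain ⟨L, hL, hdet, hpc⟩ := (hgZ Q hQ).exists_affineMaps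
      obtain ⟨Λ, hΛ, h0, hsep⟩ := exists_separating_functionals hL
      exact (hvol i).trans (measure_le_measure_image_of_piecewise volume hL hΛ h0 hsep hdet
        (hopen i) (hgc Q hQ i) (fun x hx => hpc x (hOP i hx)) (hgi Q hQ i))
  have hcl : ∀ Q ∈ D, closure (⋃₀ range fun i => g Q '' O i) = Q := by
    intro Q hQ
    have h1 : ⋃₀ range (fun i => g Q '' O i) = g Q '' interior (zRange σ) := by
      rw [sUnion_range, ← hunion, image_iUnion]
    rw [h1]
    refine Subset.antisymm (closure_minimal ?_ ?_) ?_
    · exact (image_mono interior_subset).trans (hgQ Q hQ).subset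
    · rw [← hgQ Q hQ]
      exact (hσ.isCompact_zRange.image_of_continuousOn (hgZ Q hQ).1).isClosed
    · have hcd' : closure (interior (zRange σ)) = zRange σ := hcd
      have h2 := ContinuousOn.image_closure (f := g Q) (s := interior (zRange σ))
        (by rw [hcd']; exact (hgZ Q hQ).1)
      rw [hcd', hgQ Q hQ] at h2
      exact h2
  obtain ⟨hDf, hDcard⟩ := finite_and_ncard_le_choose (D := D) (k := k) hF.1
    (fun Q => range fun i => g Q '' O i)
    (fun Q hQ Q' hQ' h => by
      have h' : (range fun i => g Q '' O i) = range fun i => g Q' '' O i := h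
      rw [← hcl Q hQ, ← hcl Q' hQ', h'])
    (by
      rintro Q hQ _ ⟨i, rfl⟩
      exact ⟨Q, hQ, i, rfl⟩)
    (fun Q hQ => by
      have hi : Function.Injective fun i => g Q '' O i := fun i j h => hinj (by
        have h' : g Q '' O i = g Q '' O j := h
        rw [← hσg Q hQ i, ← hσg Q hQ j, h'])
      rw [← image_univ, ncard_image_of_injective _ hi, ncard_univ, Nat.card_fin])
  exact ⟨hDf, hDcard.trans (Nat.choose_le_choose k hF.2)⟩

/-- For a Z-retraction `σ` whose range `P` is a nonempty closed domain:
the interior of `P` has finitely many connected components `O₁,…,O_k`, each of positive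
Lebesgue measure, and the number of Z-homeomorphism domains for `σ` is at most
`C(⌊1/λ⌋, k)` where `λ` is the minimum of the measures of the components. -/
theorem stmt4 {n : ℕ} (hn : 1 ≤ n) (σ : (Fin n → ℝ) → (Fin n → ℝ))
    (hσ : IsZRetraction σ) (hne : (zRange σ).Nonempty)
    (hcd : IsClosedDomain (zRange σ)) :
    ∃ (k : ℕ) (O : Fin k → Set (Fin n → ℝ)),
      0 < k ∧ Function.Injective O ∧
      (∀ i, ∃ x ∈ interior (zRange σ), O i = connectedComponentIn (interior (zRange σ)) x) ∧
      (∀ x ∈ interior (zRange σ), ∃ i, O i = connectedComponentIn (interior (zRange σ)) x) ∧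
      (∀ i, 0 < (volume (O i)).toReal) ∧
      {Q : Set (Fin n → ℝ) | IsZHomeoDomain σ Q}.Finite ∧
      Nat.card {Q : Set (Fin n → ℝ) // IsZHomeoDomain σ Q} ≤
        Nat.choose ⌊1 / ⨅ i, (volume (O i)).toReal⌋₊ k := by
  set U := interior (zRange σ) with hU
  have hfin := hσ.finite_components
  rw [← hU] at hfin
  have := hfin.to_subtype
  have e := (Finite.equivFin (connectedComponentIn U '' U)).symm
  set k := Nat.card (connectedComponentIn U '' U)
  let O : Fin k → Set (Fin n → ℝ) := fun i => (e i : Set (Fin n → ℝ))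
  have hO : ∀ i, ∃ x ∈ U, O i = connectedComponentIn U x := fun i => by
    obtain ⟨x, hx, h⟩ := (e i).2
    exact ⟨x, hx, h.symm⟩
  have hO' : ∀ x ∈ U, ∃ i, O i = connectedComponentIn U x := fun x hx =>
    ⟨e.symm ⟨_, x, hx, rfl⟩, by simp [O]⟩
  have hinj : Function.Injective O := Subtype.val_injective.comp e.injective
  have hUne : U.Nonempty := by
    rw [← closure_nonempty_iff, show closure U = zRange σ from hcd]
    exact hne
  have hk : 0 < k := by
    obtain ⟨x, hx⟩ := hUne
    exact Fin.pos (hO' x hx).choose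
  have : Nonempty (Fin k) := ⟨⟨0, hk⟩⟩
  have hUo : IsOpen U := isOpen_interior
  have hopen : ∀ i, IsOpen (O i) := fun i => by
    obtain ⟨x, hx, h⟩ := hO i
    rw [h]
    exact hUo.connectedComponentIn
  have hOne : ∀ i, (O i).Nonempty := fun i => by
    obtain ⟨x, hx, h⟩ := hO i
    rw [h]
    exact ⟨x, mem_connectedComponentIn hx⟩
  have hOU : ∀ i, O i ⊆ U := fun i => by
    obtain ⟨x, hx, h⟩ := hO i
    rw [h]
    exact connectedComponentIn_subset _ _
  have hOfin : ∀ i, volume (O i) ≠ ⊤ := fun i =>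
    (((measure_mono ((hOU i).trans interior_subset)).trans_lt
      hσ.isCompact_zRange.measure_lt_top)).ne
  have hpos : ∀ i, 0 < (volume (O i)).toReal := fun i =>
    ENNReal.toReal_pos ((hopen i).measure_pos volume (hOne i)).ne' (hOfin i)
  have hc : 0 < ⨅ i, (volume (O i)).toReal := by
    obtain ⟨i, hi⟩ := exists_eq_ciInf_of_finite (f := fun i => (volume (O i)).toReal)
    rw [← hi]
    exact hpos i
  obtain ⟨h1, h2⟩ := card_zHomeoDomains_le hσ hcd hinj hopen
    (fun i => by
      obtain ⟨x, hx, h⟩ := hO i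
      rw [h]
      exact isPreconnected_connectedComponentIn)
    (fun i j hij => by
      obtain ⟨x, hx, h⟩ := hO i
      obtain ⟨y, hy, h'⟩ := hO j
      by_contra hd
      obtain ⟨z, hz, hz'⟩ := not_disjoint_iff.1 hd
      rw [h] at hz
      rw [h'] at hz'
      exact hij (hinj (by rw [h, h', connectedComponentIn_eq hz, connectedComponentIn_eq hz'])))
    (Subset.antisymm (iUnion_subset hOU) fun x hx => by
      obtain ⟨i, hi⟩ := hO' x hx
      exact mem_iUnion.2 ⟨i, hi ▸ mem_connectedComponentIn hx⟩)
    hc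
    (fun i => ENNReal.ofReal_le_of_le_toReal (ciInf_le (finite_range _).bddBelow i))
  exact ⟨k, O, hk, hinj, hO, hO', hpos, h1, by rwa [← Nat.card_coe_set_eq] at h2⟩
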